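/- There exists an absolute constant C such that for all finite sets A, B of real numbers with |A| + |B| = n ≥ 2, the relation R = {(a,b) ∈ A × B : a ≤ b} admits an exact rectangle partition with at most 2n rectangles and weight at most C · n · (1 + log₂ n). -/

import Mathlib

/-- An exact rectangle partition of the relation `R` restricted to `A × B`:
a finite family of rectangles `S i × T i` with `S i ⊆ A`, `T i ⊆ B`, every rectangle
contained in `R`, and every pair of `R` (within `A × B`) covered by exactly one rectangle. -/
def IsExactRectPartition {α β : Type*} (A : Finset α) (B : Finset β)
    (R : α → β → Prop) (m : ℕ) (S : Fin m → Finset α) (T : Fin m → Finset β) : Prop :=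
  (∀ i, S i ⊆ A) ∧ (∀ i, T i ⊆ B) ∧
  (∀ i, ∀ a ∈ S i, ∀ b ∈ T i, R a b) ∧
  (∀ a ∈ A, ∀ b ∈ B, R a b → ∃! i, a ∈ S i ∧ b ∈ T i)

/-- Every finite set in a linear order has an initial segment of each admissible cardinality. -/
theorem Finset.exists_initial_subset_card_eq {α : Type*} [LinearOrder α] (V : Finset α) (j : ℕ)
    (hj : j ≤ V.card) :
    ∃ U ⊆ V, U.card = j ∧ ∀ x ∈ U, ∀ y ∈ V, y ∉ U → x < y := by
  induction j with
  | zero => exact ⟨∅, by simp, by simp, by simp⟩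
  | succ j ih =>
    obtain ⟨U, hUV, hU, hlt⟩ := ih (by omega)
    have hne : (V \ U).Nonempty := by
      rw [← Finset.card_pos, Finset.card_sdiff_of_subset hUV]
      omega
    obtain ⟨hmV, hmU⟩ := Finset.mem_sdiff.mp ((V \ U).min'_mem hne)
    refine ⟨insert ((V \ U).min' hne) U, Finset.insert_subset hmV hUV, ?_, ?_⟩
    · rw [Finset.card_insert_of_notMem hmU, hU]
    · intro x hx y hy hyU
      rw [Finset.mem_insert, not_or] at hyU
      rcases Finset.mem_insert.mp hx with rfl | hx
      · exact lt_of_le_of_ne ((V \ U).min'_le y (Finset.mem_sdiff.mpr ⟨hy, hyU.2⟩))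
          (Ne.symm hyU.1)
      · exact hlt x hx y hy hyU.2

/-- Binary partitioning of `{(a, b) ∈ A × B : a ≤ b}` with recursion depth `d`, the rectangles
being indexed by an arbitrary finite type. -/
theorem exists_rect_partition_of_card_union_le {α : Type*} [LinearOrder α] (d : ℕ)
    (A B : Finset α) (h : (A ∪ B).card ≤ 2 ^ d) :
    ∃ (ι : Type) (_ : Fintype ι) (S T : ι → Finset α),
      (∀ i, S i ⊆ A) ∧ (∀ i, T i ⊆ B) ∧ (∀ i, ∀ a ∈ S i, ∀ b ∈ T i, a ≤ b) ∧
      (∀ a ∈ A, ∀ b ∈ B, a ≤ b → ∃! i, a ∈ S i ∧ b ∈ T i) ∧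
      Fintype.card ι ≤ 2 * (A ∪ B).card - 1 ∧
      ∑ i, ((S i).card + (T i).card) ≤ (d + 1) * (A.card + B.card) := by
  induction d generalizing A B with
  | zero =>
    rcases Nat.eq_zero_or_pos (A ∪ B).card with h0 | hpos
    · obtain ⟨rfl, rfl⟩ := Finset.union_eq_empty.mp (Finset.card_eq_zero.mp h0)
      exact ⟨Empty, inferInstance, Empty.elim, Empty.elim, by simp⟩
    · refine ⟨Unit, inferInstance, fun _ => A, fun _ => B, by simp, by simp, ?_, ?_, ?_, by simp⟩
      · intro _ a ha b hb
        exact (Finset.card_le_one.mp (by simpa using h) a (Finset.mem_union_left _ ha) b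
          (Finset.mem_union_right _ hb)).le
      · intro a ha b hb _
        exact ⟨(), ⟨ha, hb⟩, fun _ _ => rfl⟩
      · rw [Fintype.card_unit]
        omega
  | succ d ih =>
    by_cases hd : (A ∪ B).card ≤ 2 ^ d
    · obtain ⟨ι, inst, S, T, hS, hT, hR, hU, hc, hw⟩ := ih A B hd
      exact ⟨ι, inst, S, T, hS, hT, hR, hU, hc, hw.trans (by gcongr; omega)⟩
    · obtain ⟨U, hUV, hUc, hlt⟩ :=
        (A ∪ B).exists_initial_subset_card_eq (2 ^ d) (by omega)
      have hlow : A ∩ U ∪ B ∩ U = U := by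
        rw [← Finset.union_inter_distrib_right, Finset.inter_eq_right.mpr hUV]
      have hhigh : A \ U ∪ B \ U = (A ∪ B) \ U := (Finset.union_sdiff_distrib A B U).symm
      have hhc : ((A ∪ B) \ U).card = (A ∪ B).card - 2 ^ d := by
        rw [Finset.card_sdiff_of_subset hUV, hUc]
      have hpow : 0 < 2 ^ d := by positivity
      obtain ⟨ι₁, inst₁, S₁, T₁, hS₁, hT₁, hR₁, hU₁, hc₁, hw₁⟩ :=
        ih (A ∩ U) (B ∩ U) (by rw [hlow, hUc])
      obtain ⟨ι₂, inst₂, S₂, T₂, hS₂, hT₂, hR₂, hU₂, hc₂, hw₂⟩ :=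
        ih (A \ U) (B \ U) (by rw [hhigh, hhc]; rw [pow_succ] at h; omega)
      rw [hlow, hUc] at hc₁
      rw [hhigh, hhc] at hc₂
      have hS₁' : ∀ i x, x ∈ S₁ i → x ∈ A ∧ x ∈ U :=
        fun i x hx => Finset.mem_inter.mp (hS₁ i hx)
      have hT₁' : ∀ i x, x ∈ T₁ i → x ∈ B ∧ x ∈ U :=
        fun i x hx => Finset.mem_inter.mp (hT₁ i hx)
      have hS₂' : ∀ i x, x ∈ S₂ i → x ∈ A ∧ x ∉ U :=
        fun i x hx => Finset.mem_sdiff.mp (hS₂ i hx)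
      have hT₂' : ∀ i x, x ∈ T₂ i → x ∈ B ∧ x ∉ U :=
        fun i x hx => Finset.mem_sdiff.mp (hT₂ i hx)
      refine ⟨Option (ι₁ ⊕ ι₂), inferInstance,
        fun i => i.elim (A ∩ U) (Sum.elim S₁ S₂), fun i => i.elim (B \ U) (Sum.elim T₁ T₂),
        ?_, ?_, ?_, ?_, ?_, ?_⟩
      · rintro (_ | i | i) x hx
        · exact (Finset.mem_inter.mp hx).1
        · exact (hS₁' i x hx).1
        · exact (hS₂' i x hx).1
      · rintro (_ | i | i) x hx
        · exact (Finset.mem_sdiff.mp hx).1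
        · exact (hT₁' i x hx).1
        · exact (hT₂' i x hx).1
      · rintro (_ | i | i) a ha b hb
        · obtain ⟨hbB, hbU⟩ := Finset.mem_sdiff.mp hb
          exact (hlt a (Finset.mem_inter.mp ha).2 b (Finset.mem_union_right _ hbB) hbU).le
        · exact hR₁ i a ha b hb
        · exact hR₂ i a ha b hb
      · intro a ha b hb hab
        by_cases haU : a ∈ U <;> by_cases hbU : b ∈ U
        · obtain ⟨i, hi, huniq⟩ := hU₁ a (Finset.mem_inter.mpr ⟨ha, haU⟩) b
            (Finset.mem_inter.mpr ⟨hb, hbU⟩) hab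
          refine ⟨some (.inl i), hi, ?_⟩
          rintro (_ | k | k) ⟨hka, hkb⟩
          · exact absurd hbU (Finset.mem_sdiff.mp hkb).2
          · rw [huniq k ⟨hka, hkb⟩]
          · exact absurd haU (hS₂' k a hka).2
        · refine ⟨none, ⟨Finset.mem_inter.mpr ⟨ha, haU⟩, Finset.mem_sdiff.mpr ⟨hb, hbU⟩⟩, ?_⟩
          rintro (_ | k | k) ⟨hka, hkb⟩
          · rfl
          · exact absurd (hT₁' k b hkb).2 hbU
          · exact absurd haU (hS₂' k a hka).2
        · exact absurd hab (hlt b hbU a (Finset.mem_union_left _ ha) haU).not_ge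
        · obtain ⟨i, hi, huniq⟩ := hU₂ a (Finset.mem_sdiff.mpr ⟨ha, haU⟩) b
            (Finset.mem_sdiff.mpr ⟨hb, hbU⟩) hab
          refine ⟨some (.inr i), hi, ?_⟩
          rintro (_ | k | k) ⟨hka, hkb⟩
          · exact absurd (Finset.mem_inter.mp hka).2 haU
          · exact absurd (hS₁' k a hka).2 haU
          · rw [huniq k ⟨hka, hkb⟩]
      · rw [Fintype.card_option, Fintype.card_sum]
        omega
      · simp only [Fintype.sum_option, Fintype.sum_sum_type, Option.elim, Sum.elim_inl,
          Sum.elim_inr]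
        have hA := Finset.card_inter_add_card_sdiff A U
        have hB := Finset.card_inter_add_card_sdiff B U
        nlinarith

/-- Binary partitioning for a non-strict inequality: for `A, B ⊆ ℝ` with `|A| + |B| = n ≥ 2`,
the relation `{(a,b) : a ≤ b}` has an exact rectangle partition with at most `2n` rectangles and
weight at most `C · n · (1 + log₂ n)`. -/
theorem nonstrict_inequality_rect_partition :
    ∃ C : ℝ, ∀ (A B : Finset ℝ) (n : ℕ), A.card + B.card = n → 2 ≤ n →
      ∃ (m : ℕ) (S : Fin m → Finset ℝ) (T : Fin m → Finset ℝ),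
        IsExactRectPartition A B (fun a b => a ≤ b) m S T ∧
        m ≤ 2 * n ∧
        (∑ i, (((S i).card : ℝ) + ((T i).card : ℝ))) ≤ C * n * (1 + Real.logb 2 n) := by
  refine ⟨2, fun A B n hn hn2 => ?_⟩
  have hk : (A ∪ B).card ≤ n := hn ▸ Finset.card_union_le A B
  obtain ⟨ι, _, S, T, hS, hT, hR, hU, hc, hw⟩ :=
    exists_rect_partition_of_card_union_le (Nat.log 2 n + 1) A B
      (hk.trans (Nat.lt_pow_succ_log_self one_lt_two n).le)
  let e := (Fintype.equivFin ι).symm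
  refine ⟨Fintype.card ι, S ∘ e, T ∘ e,
    ⟨fun i => hS _, fun i => hT _, fun i => hR _, fun a ha b hb hab => ?_⟩, by omega, ?_⟩
  · exact e.existsUnique_congr_left.mpr (by simpa using hU a ha b hb hab)
  · have hsum : ∑ i, ((((S ∘ e) i).card : ℝ) + (((T ∘ e) i).card : ℝ)) =
        ∑ i, (((S i).card : ℝ) + ((T i).card : ℝ)) :=
      e.sum_comp fun i => ((S i).card : ℝ) + ((T i).card : ℝ)
    have hlog : (Nat.log 2 n : ℝ) ≤ Real.logb 2 n := by
      exact_mod_cast Real.natLog_le_logb n 2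
    have hlog0 : (0 : ℝ) ≤ Nat.log 2 n := Nat.cast_nonneg _
    rw [hn] at hw
    rw [hsum]
    calc ∑ i, (((S i).card : ℝ) + ((T i).card : ℝ))
        ≤ ((Nat.log 2 n : ℝ) + 1 + 1) * n := by exact_mod_cast hw
      _ ≤ (2 * (1 + Real.logb 2 n)) * n := by gcongr; linarith
      _ = 2 * n * (1 + Real.logb 2 n) := by ring
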